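/- Let S be a system of quotients of a Lie triple system T over a field F and let s ∈ S. Then (T:s) is an essential ideal of T and C_T((T:s)) = 0. -/

import Mathlib

/-- A Lie triple system structure on an `F`-vector space `S`:
a trilinear map `b` satisfying `[x,x,z] = 0`, the cyclic identity and the
Leibniz (derivation) identity. -/
structure LTSStruct (F : Type*) (S : Type*) [Field F] [AddCommGroup S] [Module F S] where
  b : S → S → S → S
  add₁ : ∀ x x' y z, b (x + x') y z = b x y z + b x' y z
  smul₁ : ∀ (c : F) (x y z : S), b (c • x) y z = c • b x y z
  add₂ : ∀ x y y' z, b x (y + y') z = b x y z + b x y' z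
  smul₂ : ∀ (c : F) (x y z : S), b x (c • y) z = c • b x y z
  add₃ : ∀ x y z z', b x y (z + z') = b x y z + b x y z'
  smul₃ : ∀ (c : F) (x y z : S), b x y (c • z) = c • b x y z
  alt : ∀ x z, b x x z = 0
  cyclic : ∀ x y z, b x y z + b y z x + b z x y = 0
  leibniz : ∀ u v x y z,
    b u v (b x y z) = b (b u v x) y z + b x (b u v y) z + b x y (b u v z)

namespace LTSStruct

variable {F : Type*} [Field F] {S : Type*} [AddCommGroup S] [Module F S]

/-- `I` is an ideal of the whole Lie triple system `S`: `[I,S,S] ⊆ I`. -/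
def IsIdeal (L : LTSStruct F S) (I : Submodule F S) : Prop :=
  ∀ x ∈ I, ∀ y z : S, L.b x y z ∈ I

/-- `T` is a subsystem of `S`: `[T,T,T] ⊆ T`. -/
def IsSubsystem (L : LTSStruct F S) (T : Submodule F S) : Prop :=
  ∀ x ∈ T, ∀ y ∈ T, ∀ z ∈ T, L.b x y z ∈ T

/-- `I` is an ideal of the subsystem `T`: `I ⊆ T` and `[I,T,T] ⊆ I`. -/
def IsIdealOf (L : LTSStruct F S) (I T : Submodule F S) : Prop :=
  I ≤ T ∧ ∀ x ∈ I, ∀ y ∈ T, ∀ z ∈ T, L.b x y z ∈ I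

/-- The centralizer of a subset `I` in the whole system `S`:
`C_S(I) = {x ∈ S : [x,I,S] = [S,I,x] = 0}`. -/
def centralizer (L : LTSStruct F S) (I : Set S) : Set S :=
  {x | (∀ i ∈ I, ∀ t : S, L.b x i t = 0) ∧ (∀ t : S, ∀ i ∈ I, L.b t i x = 0)}

/-- The centralizer of a subset `I` in a subsystem `T`:
`C_T(I) = {x ∈ T : [x,I,T] = [T,I,x] = 0}`. -/
def relCentralizer (L : LTSStruct F S) (T : Submodule F S) (I : Set S) : Set S :=
  {x | x ∈ T ∧ (∀ i ∈ I, ∀ t ∈ T, L.b x i t = 0) ∧ (∀ t ∈ T, ∀ i ∈ I, L.b t i x = 0)}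

/-- The center `C(S) = {x ∈ S : [x,S,S] = 0}`. -/
def center (L : LTSStruct F S) : Set S := {x | ∀ y z : S, L.b x y z = 0}

/-- The center of a subsystem `T`: `C(T) = {x ∈ T : [x,T,T] = 0}`. -/
def relCenter (L : LTSStruct F S) (T : Submodule F S) : Set S :=
  {x | x ∈ T ∧ ∀ y ∈ T, ∀ z ∈ T, L.b x y z = 0}

/-- `S` is semiprime: `[S,I,I] ≠ 0` for every nonzero ideal `I`. -/
def IsSemiprime (L : LTSStruct F S) : Prop :=
  ∀ I : Submodule F S, L.IsIdeal I → I ≠ ⊥ → ∃ t : S, ∃ i ∈ I, ∃ j ∈ I, L.b t i j ≠ 0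

/-- `S` is prime: `[S,I,J] ≠ 0` for all nonzero ideals `I`, `J`. -/
def IsPrime (L : LTSStruct F S) : Prop :=
  ∀ I J : Submodule F S, L.IsIdeal I → L.IsIdeal J → I ≠ ⊥ → J ≠ ⊥ →
    ∃ t : S, ∃ i ∈ I, ∃ j ∈ J, L.b t i j ≠ 0

/-- `S` is nondegenerate: `[S,x,x] ≠ 0` for every nonzero `x`. -/
def IsNondegenerate (L : LTSStruct F S) : Prop :=
  ∀ x : S, x ≠ 0 → ∃ t : S, L.b t x x ≠ 0

/-- A subsystem `T` is semiprime: `[T,I,I] ≠ 0` for every nonzero ideal `I` of `T`. -/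
def RelSemiprime (L : LTSStruct F S) (T : Submodule F S) : Prop :=
  ∀ I : Submodule F S, L.IsIdealOf I T → I ≠ ⊥ → ∃ t ∈ T, ∃ i ∈ I, ∃ j ∈ I, L.b t i j ≠ 0

/-- A subsystem `T` is prime: `[T,I,J] ≠ 0` for all nonzero ideals `I`, `J` of `T`. -/
def RelPrime (L : LTSStruct F S) (T : Submodule F S) : Prop :=
  ∀ I J : Submodule F S, L.IsIdealOf I T → L.IsIdealOf J T → I ≠ ⊥ → J ≠ ⊥ →
    ∃ t ∈ T, ∃ i ∈ I, ∃ j ∈ J, L.b t i j ≠ 0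

/-- A subsystem `T` is nondegenerate: `[T,x,x] ≠ 0` for every nonzero `x ∈ T`. -/
def RelNondegenerate (L : LTSStruct F S) (T : Submodule F S) : Prop :=
  ∀ x ∈ T, x ≠ 0 → ∃ t ∈ T, L.b t x x ≠ 0

/-- An ideal `I` of `S` is essential if it hits every nonzero ideal of `S`. -/
def IsEssentialIdeal (L : LTSStruct F S) (I : Submodule F S) : Prop :=
  L.IsIdeal I ∧ ∀ J : Submodule F S, L.IsIdeal J → J ≠ ⊥ → I ⊓ J ≠ ⊥

/-- An ideal `I` of the subsystem `T` is essential in `T` if it hits every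
nonzero ideal of `T`. -/
def IsEssentialIdealOf (L : LTSStruct F S) (I T : Submodule F S) : Prop :=
  L.IsIdealOf I T ∧ ∀ J : Submodule F S, L.IsIdealOf J T → J ≠ ⊥ → I ⊓ J ≠ ⊥

/-- The elements `s`, `R(x₁,y₁)⋯R(xₙ,yₙ)(s)` with all `xᵢ, yᵢ ∈ T`, where
`R(x,y)(z) = [z,x,y]`. -/
inductive InIter (L : LTSStruct F S) (T : Submodule F S) (s : S) : S → Prop
  | base : InIter L T s s
  | step (z x y : S) : InIter L T s z → x ∈ T → y ∈ T → InIter L T s (L.b z x y)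

/-- `_T(s)`: the linear span in `S` of `s` and all `R(x₁,y₁)⋯R(xₙ,yₙ)(s)`,
`xᵢ, yᵢ ∈ T`. -/
def innerIdeal (L : LTSStruct F S) (T : Submodule F S) (s : S) : Submodule F S :=
  Submodule.span F {z | InIter L T s z}

/-- `(T:s) = {x ∈ T : [x,T,_T(s)] + [x,_T(s),T] ⊆ T}`. -/
def quotSet (L : LTSStruct F S) (T : Submodule F S) (s : S) : Set S :=
  {x | x ∈ T ∧ ∀ t ∈ T, ∀ u ∈ L.innerIdeal T s, L.b x t u ∈ T ∧ L.b x u t ∈ T}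

/-- `S` is a system of quotients of `T`. -/
def IsSystemOfQuotients (L : LTSStruct F S) (T : Submodule F S) : Prop :=
  L.IsSubsystem T ∧ ∀ s s' : S, s ≠ 0 →
    ∃ x ∈ T, ∃ y ∈ T, L.b s x y ≠ 0 ∧ (x ∈ L.quotSet T s' ∨ y ∈ L.quotSet T s')

/-- `S` is a weak system of quotients of `T`. -/
def IsWeakSystemOfQuotients (L : LTSStruct F S) (T : Submodule F S) : Prop :=
  L.IsSubsystem T ∧ ∀ s : S, s ≠ 0 → ∃ x ∈ T, ∃ y ∈ T, L.b s x y ≠ 0 ∧ L.b s x y ∈ T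

/-- `S` is ideally absorbed into `T`: for every `0 ≠ s ∈ S` there is an ideal `I`
of `T` with `C_T(I) = 0` and `0 ≠ [s,I,T] + [s,T,I] ⊆ T`. -/
def IsIdeallyAbsorbed (L : LTSStruct F S) (T : Submodule F S) : Prop :=
  L.IsSubsystem T ∧ ∀ s : S, s ≠ 0 → ∃ I : Submodule F S, L.IsIdealOf I T ∧
    L.relCentralizer T (I : Set S) = {0} ∧
    (∃ i ∈ I, ∃ t ∈ T, L.b s i t ≠ 0 ∨ L.b s t i ≠ 0) ∧
    (∀ i ∈ I, ∀ t ∈ T, L.b s i t ∈ T ∧ L.b s t i ∈ T)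

end LTSStruct

namespace LTSStruct

variable {F : Type*} [Field F] {S : Type*} [AddCommGroup S] [Module F S]

theorem b_skew (L : LTSStruct F S) (x y z : S) : L.b x y z = -L.b y x z := by
  have h := L.alt (x + y) z
  rw [L.add₁, L.add₂, L.add₂, L.alt, L.alt, zero_add, add_zero] at h
  exact eq_neg_of_add_eq_zero_left h

theorem b_eq_sub (L : LTSStruct F S) (x y z : S) : L.b x y z = L.b z y x - L.b z x y := by
  have h := L.cyclic x y z
  rw [L.b_skew y z x] at h
  rw [← sub_eq_zero, ← h]
  abel

theorem b_zero₁ (L : LTSStruct F S) (y z : S) : L.b 0 y z = 0 := by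
  simpa using L.smul₁ (0 : F) 0 y z

section innerIdeal

variable (L : LTSStruct F S) {T : Submodule F S} {s u x y : S}

theorem b_mem_innerIdeal (hu : u ∈ L.innerIdeal T s) (hx : x ∈ T) (hy : y ∈ T) :
    L.b u x y ∈ L.innerIdeal T s := by
  induction hu using Submodule.span_induction with
  | mem z hz => exact Submodule.subset_span (InIter.step z x y hz hx hy)
  | zero => rw [L.b_zero₁]; exact Submodule.zero_mem _
  | add z w _ _ hz hw => rw [L.add₁]; exact Submodule.add_mem _ hz hw
  | smul c z _ hz => rw [L.smul₁]; exact Submodule.smul_mem _ c hz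

theorem b_mem_innerIdeal₂ (hx : x ∈ T) (hu : u ∈ L.innerIdeal T s) (hy : y ∈ T) :
    L.b x u y ∈ L.innerIdeal T s := by
  rw [L.b_skew]
  exact Submodule.neg_mem _ (L.b_mem_innerIdeal hu hx hy)

theorem b_mem_innerIdeal₃ (hx : x ∈ T) (hy : y ∈ T) (hu : u ∈ L.innerIdeal T s) :
    L.b x y u ∈ L.innerIdeal T s := by
  rw [L.b_eq_sub]
  exact Submodule.sub_mem _ (L.b_mem_innerIdeal hu hy hx) (L.b_mem_innerIdeal hu hx hy)

end innerIdeal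

/-- `(T:s)` as a subspace. -/
def quotSubmodule (L : LTSStruct F S) (T : Submodule F S) (s : S) : Submodule F S where
  carrier := L.quotSet T s
  add_mem' := by
    rintro x y ⟨hx, hx'⟩ ⟨hy, hy'⟩
    refine ⟨T.add_mem hx hy, fun t ht u hu => ?_⟩
    rw [L.add₁, L.add₁]
    exact ⟨T.add_mem (hx' t ht u hu).1 (hy' t ht u hu).1,
      T.add_mem (hx' t ht u hu).2 (hy' t ht u hu).2⟩
  zero_mem' := by
    refine ⟨T.zero_mem, fun t _ u _ => ?_⟩
    rw [L.b_zero₁, L.b_zero₁]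
    exact ⟨T.zero_mem, T.zero_mem⟩
  smul_mem' := by
    rintro c x ⟨hx, hx'⟩
    refine ⟨T.smul_mem c hx, fun t ht u hu => ?_⟩
    rw [L.smul₁, L.smul₁]
    exact ⟨T.smul_mem c (hx' t ht u hu).1, T.smul_mem c (hx' t ht u hu).2⟩

theorem isIdealOf_quotSubmodule (L : LTSStruct F S) {T : Submodule F S} (hT : L.IsSubsystem T)
    (s : S) : L.IsIdealOf (L.quotSubmodule T s) T := by
  refine ⟨fun x hx => hx.1, ?_⟩
  rintro x ⟨hx, hxq⟩ a ha b hb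
  have mem₃ : ∀ t ∈ T, ∀ u ∈ L.innerIdeal T s, L.b x t u ∈ T := fun t ht u hu => (hxq t ht u hu).1
  have mem₂ : ∀ t ∈ T, ∀ u ∈ L.innerIdeal T s, L.b x u t ∈ T := fun t ht u hu => (hxq t ht u hu).2
  have key : ∀ c ∈ T, ∀ d ∈ T, ∀ e ∈ T, ∀ u ∈ L.innerIdeal T s,
      L.b c u (L.b x d e) ∈ T := by
    intro c hc d hd e he u hu
    have hcux : L.b c u x ∈ T := by
      rw [L.b_eq_sub]
      exact T.sub_mem (mem₂ c hc u hu) (mem₃ c hc u hu)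
    rw [L.leibniz]
    exact T.add_mem (T.add_mem (hT _ hcux _ hd _ he)
      (mem₂ e he _ (L.b_mem_innerIdeal₂ hc hu hd))) (mem₃ d hd _ (L.b_mem_innerIdeal₂ hc hu he))
  refine ⟨hT x hx a ha b hb, fun t ht u hu => ?_⟩
  have second : L.b (L.b x a b) u t ∈ T := by
    have h := L.leibniz x a b u t
    have e : L.b (L.b x a b) u t =
        L.b x a (L.b b u t) - L.b b (L.b x a u) t - L.b b u (L.b x a t) := by
      rw [h]; abel
    rw [e]
    exact T.sub_mem (T.sub_mem (mem₃ a ha _ (L.b_mem_innerIdeal₂ hb hu ht))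
      (hT b hb _ (mem₃ a ha u hu) t ht)) (key b hb a ha t ht u hu)
  refine ⟨?_, second⟩
  have e : L.b (L.b x a b) t u = L.b (L.b x a b) u t - L.b t u (L.b x a b) := by
    rw [L.b_eq_sub t u]; abel
  rw [e]
  exact T.sub_mem second (key t ht a ha b hb u hu)

end LTSStruct

/-- if `S` is a system of quotients of `T` and `s ∈ S`, then
`(T:s)` is an essential ideal of `T` and `C_T((T:s)) = 0`. -/
theorem quotSet_essential_of_isSystemOfQuotients
    {F S : Type*} [Field F] [AddCommGroup S] [Module F S]
    (L : LTSStruct F S) (T : Submodule F S) (h : L.IsSystemOfQuotients T) (s : S) :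
    (∃ Q : Submodule F S, (Q : Set S) = L.quotSet T s ∧ L.IsEssentialIdealOf Q T) ∧
    L.relCentralizer T (L.quotSet T s) = {0} := by
  obtain ⟨hT, hS⟩ := h
  have hQ := L.isIdealOf_quotSubmodule hT s
  refine ⟨⟨L.quotSubmodule T s, rfl, hQ, fun J hJ hJ0 hbot => ?_⟩, ?_⟩
  · obtain ⟨x, hxJ, hx0⟩ := J.exists_mem_ne_zero_of_ne_bot hJ0
    obtain ⟨a, ha, b, hb, hne, hab⟩ := hS x s hx0
    have hxT := hJ.1 hxJ
    refine hne ((Submodule.mem_bot F).1 (hbot ▸ ⟨?_, hJ.2 x hxJ a ha b hb⟩))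
    rcases hab with haQ | hbQ
    · rw [L.b_skew]
      exact Submodule.neg_mem _ (hQ.2 a haQ x hxT b hb)
    · rw [L.b_eq_sub]
      exact Submodule.sub_mem _ (hQ.2 b hbQ a ha x hxT) (hQ.2 b hbQ x hxT a ha)
  · refine Set.Subset.antisymm ?_ ?_
    · rintro x ⟨-, hx₂, hx₃⟩
      by_contra hx0
      obtain ⟨a, ha, b, hb, hne, haQ | hbQ⟩ := hS x s hx0
      · exact hne (hx₂ a haQ b hb)
      · apply hne
        rw [L.b_eq_sub, L.b_skew b a, L.b_skew b x, hx₃ a ha b hbQ, hx₂ b hbQ a ha]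
        simp
    · rintro _ rfl
      refine ⟨T.zero_mem, fun i _ t _ => L.b_zero₁ i t, fun t _ i _ => ?_⟩
      rw [L.b_eq_sub, L.b_zero₁, L.b_zero₁, sub_zero]
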